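/- Let B be an instance of (2,2)-E3-SAT and let J be the TAP instance constructed from B as described. Then every stable matching M in J contains, for each i (1≤i≤n), either all the pairs in T_i or all the pairs in F_i. -/

import Mathlib

structure TAP (A : Type*) (S : Type*) (P : Type*) where
  ptype : A → Finset P
  prefA : A → List S
  cap : S → P → ℕ
  prefS : S → List A

namespace TAP

variable {A S P : Type*} [DecidableEq A] [DecidableEq S] [DecidableEq P] (J : TAP A S P)

def WellFormed : Prop :=
  (∀ a, (J.ptype a).card = 2) ∧ (∀ a, (J.prefA a).Nodup) ∧
  (∀ s, (J.prefS s).Nodup) ∧ (∀ a s, a ∈ J.prefS s ↔ s ∈ J.prefA a)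

def IsAssignment (M : Finset (A × S)) : Prop :=
  (∀ x ∈ M, x.2 ∈ J.prefA x.1) ∧
  ∀ a s s', (a, s) ∈ M → (a, s') ∈ M → s = s'

def Mp (M : Finset (A × S)) (s : S) (p : P) : Finset A :=
  (M.filter (fun x => x.2 = s ∧ p ∈ J.ptype x.1)).image Prod.fst

def Mpr (M : Finset (A × S)) (s : S) (p r : P) : Finset A :=
  (M.filter (fun x => x.2 = s ∧ J.ptype x.1 = {p, r})).image Prod.fst

def IsMatching (M : Finset (A × S)) : Prop :=
  J.IsAssignment M ∧ ∀ s p, (J.Mp M s p).card ≤ J.cap s p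

def Undersub (M : Finset (A × S)) (s : S) (p : P) : Prop :=
  (J.Mp M s p).card < J.cap s p

def PrefersA (a : A) (s s' : S) : Prop :=
  s ∈ J.prefA a ∧ s' ∈ J.prefA a ∧ (J.prefA a).idxOf s < (J.prefA a).idxOf s'

def PrefersS (s : S) (a a' : A) : Prop :=
  a ∈ J.prefS s ∧ a' ∈ J.prefS s ∧ (J.prefS s).idxOf a < (J.prefS s).idxOf a'

def Unassigned (M : Finset (A × S)) (a : A) : Prop := ∀ s, (a, s) ∉ M

def Blocks (M : Finset (A × S)) (a : A) (s : S) : Prop :=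
  s ∈ J.prefA a ∧
  (Unassigned M a ∨ ∃ s', (a, s') ∈ M ∧ J.PrefersA a s s') ∧
  ∃ p₁ p₂, p₁ ≠ p₂ ∧ J.ptype a = {p₁, p₂} ∧
    ((J.Undersub M s p₁ ∧ J.Undersub M s p₂) ∨
     (J.Undersub M s p₁ ∧ ∃ b ∈ J.Mp M s p₂, J.PrefersS s a b) ∨
     (J.Undersub M s p₂ ∧ ∃ b ∈ J.Mp M s p₁, J.PrefersS s a b) ∨
     (∃ b ∈ J.Mpr M s p₁ p₂, J.PrefersS s a b) ∨
     (∃ b₁ ∈ J.Mp M s p₁, ∃ b₂ ∈ J.Mp M s p₂, b₁ ≠ b₂ ∧ J.PrefersS s a b₁ ∧ J.PrefersS s a b₂))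

def Stable (M : Finset (A × S)) : Prop :=
  J.IsMatching M ∧ ∀ a s, ¬ J.Blocks M a s

end TAP
/-- The three subjects. -/
inductive Subj : Type where
  | F | I | M
deriving DecidableEq

/-- An instance of (2,2)-E3-SAT with variables `Fin n` and clauses `Fin m`:
`clause j t` is the literal (variable, polarity) in position `t` of clause `j`;
`occurs v b o` is the (clause, position) of the `o`-th occurrence of the literal
`(v, b)`, and `occInv` is its two-sided inverse, so that each clause has exactly
3 literals and each literal occurs exactly twice. -/
structure E3SAT (n m : ℕ) where
  clause : Fin m → Fin 3 → Fin n × Bool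
  occurs : Fin n → Bool → Fin 2 → Fin m × Fin 3
  occInv : Fin m → Fin 3 → Fin n × Bool × Fin 2
  clause_occurs : ∀ v b o, clause (occurs v b o).1 (occurs v b o).2 = (v, b)
  occurs_occInv : ∀ j t, occurs (occInv j t).1 (occInv j t).2.1 (occInv j t).2.2 = (j, t)
  occInv_occurs : ∀ v b o, occInv (occurs v b o).1 (occurs v b o).2 = (v, b, o)

/-- `f` is a satisfying truth assignment of `B`. -/
def E3SAT.Satisfies {n m : ℕ} (B : E3SAT n m) (f : Fin n → Bool) : Prop :=
  ∀ j : Fin m, ∃ t : Fin 3, f (B.clause j t).1 = (B.clause j t).2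
/-- The applicants of the TAP instance constructed from a (2,2)-E3-SAT instance.
Indices are 0-based: `a i r` is the applicant `a_{i+1}^{r+1}` of the paper,
`x i r` is `x_{i+1}^{r+1}`, `y i r` is `y_{i+1}^{r+1}` and `q i t k` is
`q_{i+1,t+1}^{k+1}`. -/
inductive TApp (n m : ℕ) : Type where
  | a (i : Fin n) (r : Fin 6)
  | x (i : Fin n) (r : Fin 2)
  | y (i : Fin n) (r : Fin 2)
  | q (i : Fin n) (t : Fin 3) (k : Fin 4)
deriving DecidableEq

/-- The schools of the TAP instance constructed from a (2,2)-E3-SAT instance.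
`s i r` is the school `s_{i+1}^{r+1}` of the paper, `w i t k` is `w_{i+1,t+1}^{k+1}`
and `z j` is `z_{j+1}`. -/
inductive TSch (n m : ℕ) : Type where
  | s (i : Fin n) (r : Fin 4)
  | sT (i : Fin n)
  | sF (i : Fin n)
  | w (i : Fin n) (t : Fin 3) (k : Fin 4)
  | z (j : Fin m)
deriving DecidableEq

namespace TApp

variable {n m : ℕ}

/-- The applicant `A(w_{i,3}^k)`: `x_i^k` for `k ∈ {1,2}` and `y_i^{k-2}` for `k ∈ {3,4}`. -/
def Aw (i : Fin n) (k : Fin 4) : TApp n m :=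
  if h : k.1 < 2 then .x i ⟨k.1, h⟩ else .y i ⟨k.1 - 2, by have := k.2; omega⟩

/-- The x- or y-applicant corresponding to the literal occurrence in position `t`
of clause `j`. -/
def litApp (B : E3SAT n m) (j : Fin m) (t : Fin 3) : TApp n m :=
  if (B.occInv j t).2.1 then .x (B.occInv j t).1 (B.occInv j t).2.2
  else .y (B.occInv j t).1 (B.occInv j t).2.2

end TApp

open Subj in
/-- The TAP instance `J` constructed from the (2,2)-E3-SAT instance `B`. -/
def tapOf {n m : ℕ} (B : E3SAT n m) : TAP (TApp n m) (TSch n m) Subj where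
  ptype
    | .a _ r => if r = 2 then {F, M} else if r = 3 then {I, M} else {F, I}
    | .x _ r => if r = 0 then {F, M} else {I, M}
    | .y _ r => if r = 0 then {F, M} else {I, M}
    | .q _ t _ => if t = 0 then {F, M} else if t = 1 then {I, M} else {F, I}
  prefA
    | .a i r =>
        if r = 0 then [.s i 0, .s i 2]
        else if r = 1 then [.s i 1, .s i 3]
        else if r = 2 then [.s i 0, .s i 1]
        else if r = 3 then [.s i 1, .s i 0]
        else if r = 4 then [.s i 2, .sT i]
        else [.s i 3, .sF i]
    | .x i r => [.sT i, .z (B.occurs i true r).1, .w i 2 ⟨r.1, by have := r.2; omega⟩]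
    | .y i r => [.sF i, .z (B.occurs i false r).1, .w i 2 ⟨r.1 + 2, by have := r.2; omega⟩]
    | .q i t k =>
        if t = 0 then [.w i 1 k, .w i 0 k]
        else if t = 1 then [.w i 0 k, .w i 1 k]
        else [.w i 2 k, .w i 0 k]
  cap
    | .s _ r, p => if p = M then (if r = 0 ∨ r = 1 then 2 else 0) else 1
    | .sT _, p => if p = M then 2 else 1
    | .sF _, p => if p = M then 2 else 1
    | .w _ t _, p => if p = M then (if t = 2 then 1 else 2) else 1
    | .z _, _ => 2
  prefS
    | .s i r =>
        if r = 0 then [.a i 3, .a i 0, .a i 2]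
        else if r = 1 then [.a i 2, .a i 1, .a i 3]
        else if r = 2 then [.a i 0, .a i 4]
        else [.a i 1, .a i 5]
    | .sT i => [.a i 4, .x i 0, .x i 1]
    | .sF i => [.a i 5, .y i 0, .y i 1]
    | .w i t k =>
        if t = 0 then [.q i 0 k, .q i 2 k, .q i 1 k]
        else if t = 1 then [.q i 1 k, .q i 0 k]
        else [TApp.Aw i k, .q i 2 k]
    | .z j => [.litApp B j 0, .litApp B j 1, .litApp B j 2]

/-- The set of pairs `T_i`. -/
def Tset {n m : ℕ} (i : Fin n) : Finset (TApp n m × TSch n m) :=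
  {(.x i 0, .sT i), (.x i 1, .sT i), (.a i 5, .sF i)}

/-- The set of pairs `F_i`. -/
def Fset {n m : ℕ} (i : Fin n) : Finset (TApp n m × TSch n m) :=
  {(.y i 0, .sF i), (.y i 1, .sF i), (.a i 4, .sT i)}
theorem List.idxOf_lt_idxOf_of_append_cons {α : Type*} [DecidableEq α] {l₁ l₂ : List α} {a b : α}
    (hb : b ∉ l₁) (hab : b ≠ a) :
    (l₁ ++ a :: l₂).idxOf a < (l₁ ++ a :: l₂).idxOf b := by
  have h₁ : (l₁ ++ a :: l₂).idxOf a ≤ l₁.length := by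
    rw [List.idxOf_append]
    split_ifs with h
    · exact (List.idxOf_lt_length_of_mem h).le
    · simp
  have h₂ : (l₁ ++ a :: l₂).idxOf b = l₁.length + (l₂.idxOf b + 1) := by
    rw [List.idxOf_append_of_notMem hb, List.idxOf_cons_ne _ hab.symm]
  omega

namespace TAP

theorem IsAssignment.not_both_mem {A S P : Type*} {J : TAP A S P} {M : Finset (A × S)}
    (hM : J.IsAssignment M) (a : A) {s s' : S} (hs : s ≠ s') :
    ¬((a, s) ∈ M ∧ (a, s') ∈ M) :=
  fun h => hs (hM.2 a s s' h.1 h.2)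

variable {A S P : Type*} [DecidableEq A] [DecidableEq S] [DecidableEq P] {J : TAP A S P}
  {M : Finset (A × S)}

theorem mem_Mp {s : S} {p : P} {b : A} : b ∈ J.Mp M s p ↔ (b, s) ∈ M ∧ p ∈ J.ptype b := by
  simp [Mp]

theorem mem_Mpr {s : S} {p r : P} {b : A} :
    b ∈ J.Mpr M s p r ↔ (b, s) ∈ M ∧ J.ptype b = {p, r} := by
  simp [Mpr]

/-- Two applicants sharing a subject of capacity one are not assigned to the same school. -/
theorem IsMatching.not_both_mem (hM : J.IsMatching M) {s : S} (p : P) (hcap : J.cap s p = 1)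
    {a b : A} (hab : a ≠ b) (ha : p ∈ J.ptype a) (hb : p ∈ J.ptype b) :
    ¬((a, s) ∈ M ∧ (b, s) ∈ M) := by
  rintro ⟨has, hbs⟩
  have h := hM.2 s p
  rw [hcap, Finset.card_le_one] at h
  exact hab (h a (mem_Mp.2 ⟨has, ha⟩) b (mem_Mp.2 ⟨hbs, hb⟩))

/-- If an applicant would like to move to `s`, then in one of its subjects `s` is full and holds
no worse applicant. -/
theorem Stable.exists_full (hM : J.Stable M) {a : A} {s : S}
    (hcard : ∀ b, (J.ptype b).card = 2) (hs : s ∈ J.prefA a)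
    (hwant : Unassigned M a ∨ ∃ s', (a, s') ∈ M ∧ J.PrefersA a s s') :
    ∃ p ∈ J.ptype a, ¬J.Undersub M s p ∧ ∀ b ∈ J.Mp M s p, ¬J.PrefersS s a b := by
  by_contra! hcon
  obtain ⟨p₁, p₂, hne, hp⟩ := Finset.card_eq_two.1 (hcard a)
  have h₁ := hcon p₁ (by simp [hp])
  have h₂ := hcon p₂ (by simp [hp])
  refine hM.2 a s ⟨hs, hwant, p₁, p₂, hne, hp, ?_⟩
  by_cases hu₁ : J.Undersub M s p₁
  · by_cases hu₂ : J.Undersub M s p₂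
    · exact .inl ⟨hu₁, hu₂⟩
    · exact .inr (.inl ⟨hu₁, h₂ hu₂⟩)
  obtain ⟨b₁, hb₁, hab₁⟩ := h₁ hu₁
  by_cases hu₂ : J.Undersub M s p₂
  · exact .inr (.inr (.inl ⟨hu₂, b₁, hb₁, hab₁⟩))
  obtain ⟨b₂, hb₂, hab₂⟩ := h₂ hu₂
  by_cases hb : b₁ = b₂
  · subst hb
    refine .inr (.inr (.inr (.inl ⟨b₁, mem_Mpr.2 ⟨(mem_Mp.1 hb₁).1, ?_⟩, hab₁⟩)))
    refine (Finset.eq_of_subset_of_card_le (Finset.insert_subset (mem_Mp.1 hb₁).2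
      (Finset.singleton_subset_iff.2 (mem_Mp.1 hb₂).2)) ?_).symm
    rw [hcard, Finset.card_pair hne]
  · exact .inr (.inr (.inr (.inr ⟨b₁, hb₁, b₂, hb₂, hb, hab₁, hab₂⟩)))

/-- In a stable matching, an applicant not assigned to a school it prefers to `s` is assigned to
`s`, unless better applicants fill `s` in one of its subjects. -/
theorem Stable.mem_of_countP_lt (hM : J.Stable M) {a : A} {s : S} (k₁ k₂ : List S)
    (l₁ l₂ : List A) (hcard : ∀ b, (J.ptype b).card = 2)
    (hmem : ∀ b, s ∈ J.prefA b → b ∈ J.prefS s)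
    (hA : J.prefA a = k₁ ++ s :: k₂) (hS : J.prefS s = l₁ ++ a :: l₂)
    (hk₁ : ∀ s' ∈ k₁, (a, s') ∉ M)
    (hl₁ : ∀ p ∈ J.ptype a, l₁.countP (fun b => (b, s) ∈ M ∧ p ∈ J.ptype b) < J.cap s p) :
    (a, s) ∈ M := by
  by_contra has
  have hs : s ∈ J.prefA a := by simp [hA]
  have hwant : Unassigned M a ∨ ∃ s', (a, s') ∈ M ∧ J.PrefersA a s s' := by
    refine or_iff_not_imp_left.2 fun h => ?_
    obtain ⟨s', hs'⟩ := not_forall_not.1 h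
    refine ⟨s', hs', hs, hM.1.1.1 _ hs', ?_⟩
    rw [hA]
    exact List.idxOf_lt_idxOf_of_append_cons (fun h' => hk₁ s' h' hs')
      (by rintro rfl; exact has hs')
  obtain ⟨p, hp, hfull, hbest⟩ := hM.exists_full hcard hs hwant
  refine hfull (lt_of_le_of_lt ?_ (hl₁ p hp))
  rw [List.countP_eq_length_filter]
  refine (Finset.card_le_card fun b hb => ?_).trans (List.toFinset_card_le _)
  have hb' := mem_Mp.1 hb
  have hbl : b ∈ l₁ := by
    by_contra h
    refine hbest b hb ⟨by simp [hS], hmem b (hM.1.1.1 _ hb'.1), ?_⟩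
    rw [hS]
    exact List.idxOf_lt_idxOf_of_append_cons h (by rintro rfl; exact has hb'.1)
  simpa using ⟨hbl, hb'⟩

end TAP

section tapOf

variable {n m : ℕ} (B : E3SAT n m)

theorem card_ptype_tapOf (b : TApp n m) : ((tapOf B).ptype b).card = 2 := by
  cases b <;> simp only [tapOf] <;> split_ifs <;> rfl

theorem mem_prefS_s {i : Fin n} {r : Fin 4} (b : TApp n m) (h : .s i r ∈ (tapOf B).prefA b) :
    b ∈ (tapOf B).prefS (.s i r) := by
  cases b with
  | a j t => fin_cases t <;> simp [tapOf] at h ⊢ <;> aesop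
  | x => simp [tapOf] at h
  | y => simp [tapOf] at h
  | q j t k => fin_cases t <;> simp [tapOf] at h

theorem mem_prefS_sT {i : Fin n} (b : TApp n m) (h : .sT i ∈ (tapOf B).prefA b) :
    b ∈ (tapOf B).prefS (.sT i) := by
  cases b with
  | a j t => fin_cases t <;> simp [tapOf] at h ⊢; exact h.symm
  | x j t => fin_cases t <;> simp [tapOf] at h ⊢ <;> exact h.symm
  | y => simp [tapOf] at h
  | q j t k => fin_cases t <;> simp [tapOf] at h

theorem mem_prefS_sF {i : Fin n} (b : TApp n m) (h : .sF i ∈ (tapOf B).prefA b) :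
    b ∈ (tapOf B).prefS (.sF i) := by
  cases b with
  | a j t => fin_cases t <;> simp [tapOf] at h ⊢; exact h.symm
  | x => simp [tapOf] at h
  | y j t => fin_cases t <;> simp [tapOf] at h ⊢ <;> exact h.symm
  | q j t k => fin_cases t <;> simp [tapOf] at h

end tapOf

theorem stmt7 {n m : ℕ} (B : E3SAT n m) (M : Finset (TApp n m × TSch n m))
    (hM : (tapOf B).Stable M) (i : Fin n) :
    Tset i ⊆ M ∨ Fset i ⊆ M := by
  have h_a0_s0 : ((.a i 3, .s i 0) : TApp n m × TSch n m) ∉ M →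
      ((.a i 0, .s i 0) : TApp n m × TSch n m) ∈ M := by
    intro h
    refine hM.mem_of_countP_lt [] _ [.a i 3] _ (card_ptype_tapOf B) (mem_prefS_s B) rfl rfl
      (by simp) ?_
    rintro (_ | _ | _) <;> simp [tapOf, h]
  have h_a1_s1 : ((.a i 2, .s i 1) : TApp n m × TSch n m) ∉ M →
      ((.a i 1, .s i 1) : TApp n m × TSch n m) ∈ M := by
    intro h
    refine hM.mem_of_countP_lt [] _ [.a i 2] _ (card_ptype_tapOf B) (mem_prefS_s B) rfl rfl
      (by simp) ?_
    rintro (_ | _ | _) <;> simp [tapOf, h]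
  have h_a2_s0 : ((.a i 0, .s i 0) : TApp n m × TSch n m) ∉ M →
      ((.a i 2, .s i 0) : TApp n m × TSch n m) ∈ M := by
    intro h
    refine hM.mem_of_countP_lt [] _ [.a i 3, .a i 0] _ (card_ptype_tapOf B) (mem_prefS_s B) rfl rfl
      (by simp) ?_
    rintro (_ | _ | _) <;> simp [tapOf, List.countP_cons, h]
    split_ifs <;> simp
  have h_a3_s1 : ((.a i 1, .s i 1) : TApp n m × TSch n m) ∉ M →
      ((.a i 3, .s i 1) : TApp n m × TSch n m) ∈ M := by
    intro h
    refine hM.mem_of_countP_lt [] _ [.a i 2, .a i 1] _ (card_ptype_tapOf B) (mem_prefS_s B) rfl rfl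
      (by simp) ?_
    rintro (_ | _ | _) <;> simp [tapOf, List.countP_cons, h]
    split_ifs <;> simp
  have h_a3_s0 : ((.a i 3, .s i 1) : TApp n m × TSch n m) ∉ M →
      ((.a i 3, .s i 0) : TApp n m × TSch n m) ∈ M := by
    intro h
    refine hM.mem_of_countP_lt [.s i 1] _ [] _ (card_ptype_tapOf B) (mem_prefS_s B) rfl rfl
      (by simp [h]) ?_
    rintro (_ | _ | _) <;> simp [tapOf]
  have h_a0_s2 : ((.a i 0, .s i 0) : TApp n m × TSch n m) ∉ M →
      ((.a i 0, .s i 2) : TApp n m × TSch n m) ∈ M := by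
    intro h
    refine hM.mem_of_countP_lt [.s i 0] _ [] _ (card_ptype_tapOf B) (mem_prefS_s B) rfl rfl
      (by simp [h]) ?_
    rintro (_ | _ | _) <;> simp [tapOf]
  have h_a1_s3 : ((.a i 1, .s i 1) : TApp n m × TSch n m) ∉ M →
      ((.a i 1, .s i 3) : TApp n m × TSch n m) ∈ M := by
    intro h
    refine hM.mem_of_countP_lt [.s i 1] _ [] _ (card_ptype_tapOf B) (mem_prefS_s B) rfl rfl
      (by simp [h]) ?_
    rintro (_ | _ | _) <;> simp [tapOf]
  have h_a4_s2 : ((.a i 0, .s i 2) : TApp n m × TSch n m) ∉ M →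
      ((.a i 4, .s i 2) : TApp n m × TSch n m) ∈ M := by
    intro h
    refine hM.mem_of_countP_lt [] _ [.a i 0] _ (card_ptype_tapOf B) (mem_prefS_s B) rfl rfl
      (by simp) ?_
    rintro (_ | _ | _) <;> simp [tapOf, h]
  have h_a5_s3 : ((.a i 1, .s i 3) : TApp n m × TSch n m) ∉ M →
      ((.a i 5, .s i 3) : TApp n m × TSch n m) ∈ M := by
    intro h
    refine hM.mem_of_countP_lt [] _ [.a i 1] _ (card_ptype_tapOf B) (mem_prefS_s B) rfl rfl
      (by simp) ?_
    rintro (_ | _ | _) <;> simp [tapOf, h]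
  have h_a4_sT : ((.a i 4, .s i 2) : TApp n m × TSch n m) ∉ M →
      ((.a i 4, .sT i) : TApp n m × TSch n m) ∈ M := by
    intro h
    refine hM.mem_of_countP_lt [.s i 2] _ [] _ (card_ptype_tapOf B) (mem_prefS_sT B)
      rfl rfl (by simp [h]) ?_
    rintro (_ | _ | _) <;> simp [tapOf]
  have h_a5_sF : ((.a i 5, .s i 3) : TApp n m × TSch n m) ∉ M →
      ((.a i 5, .sF i) : TApp n m × TSch n m) ∈ M := by
    intro h
    refine hM.mem_of_countP_lt [.s i 3] _ [] _ (card_ptype_tapOf B) (mem_prefS_sF B)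
      rfl rfl (by simp [h]) ?_
    rintro (_ | _ | _) <;> simp [tapOf]
  have h_x0_sT : ((.a i 4, .sT i) : TApp n m × TSch n m) ∉ M →
      ((.x i 0, .sT i) : TApp n m × TSch n m) ∈ M := by
    intro h
    refine hM.mem_of_countP_lt [] _ [.a i 4] _ (card_ptype_tapOf B) (mem_prefS_sT B)
      rfl rfl (by simp) ?_
    rintro (_ | _ | _) <;> simp [tapOf, h]
  have h_x1_sT : ((.a i 4, .sT i) : TApp n m × TSch n m) ∉ M →
      ((.x i 1, .sT i) : TApp n m × TSch n m) ∈ M := by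
    intro h
    refine hM.mem_of_countP_lt [] _ [.a i 4, .x i 0] _ (card_ptype_tapOf B) (mem_prefS_sT B)
      rfl rfl (by simp) ?_
    rintro (_ | _ | _) <;> simp [tapOf, List.countP_cons, h]
    split_ifs <;> simp
  have h_y0_sF : ((.a i 5, .sF i) : TApp n m × TSch n m) ∉ M →
      ((.y i 0, .sF i) : TApp n m × TSch n m) ∈ M := by
    intro h
    refine hM.mem_of_countP_lt [] _ [.a i 5] _ (card_ptype_tapOf B) (mem_prefS_sF B)
      rfl rfl (by simp) ?_
    rintro (_ | _ | _) <;> simp [tapOf, h]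
  have h_y1_sF : ((.a i 5, .sF i) : TApp n m × TSch n m) ∉ M →
      ((.y i 1, .sF i) : TApp n m × TSch n m) ∈ M := by
    intro h
    refine hM.mem_of_countP_lt [] _ [.a i 5, .y i 0] _ (card_ptype_tapOf B) (mem_prefS_sF B)
      rfl rfl (by simp) ?_
    rintro (_ | _ | _) <;> simp [tapOf, List.countP_cons, h]
    split_ifs <;> simp
  have e_a0_a2 := hM.1.not_both_mem (s := .s i 0) Subj.F (by simp [tapOf]) (a := .a i 0)
    (b := .a i 2) (by simp) (by simp [tapOf]) (by simp [tapOf])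
  have e_a0_a3 := hM.1.not_both_mem (s := .s i 0) Subj.I (by simp [tapOf]) (a := .a i 0)
    (b := .a i 3) (by simp) (by simp [tapOf]) (by simp [tapOf])
  have e_a1_a2 := hM.1.not_both_mem (s := .s i 1) Subj.F (by simp [tapOf]) (a := .a i 1)
    (b := .a i 2) (by simp) (by simp [tapOf]) (by simp [tapOf])
  have e_a1_a3 := hM.1.not_both_mem (s := .s i 1) Subj.I (by simp [tapOf]) (a := .a i 1)
    (b := .a i 3) (by simp) (by simp [tapOf]) (by simp [tapOf])
  have e_a0_a4 := hM.1.not_both_mem (s := .s i 2) Subj.F (by simp [tapOf]) (a := .a i 0)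
    (b := .a i 4) (by simp) (by simp [tapOf]) (by simp [tapOf])
  have e_a1_a5 := hM.1.not_both_mem (s := .s i 3) Subj.F (by simp [tapOf]) (a := .a i 1)
    (b := .a i 5) (by simp) (by simp [tapOf]) (by simp [tapOf])
  have d_a0 := hM.1.1.not_both_mem (.a i 0) (s := .s i 0) (s' := .s i 2) (by simp)
  have d_a1 := hM.1.1.not_both_mem (.a i 1) (s := .s i 1) (s' := .s i 3) (by simp)
  have d_a2 := hM.1.1.not_both_mem (.a i 2) (s := .s i 0) (s' := .s i 1) (by simp)
  have d_a3 := hM.1.1.not_both_mem (.a i 3) (s := .s i 1) (s' := .s i 0) (by simp)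
  have d_a4 := hM.1.1.not_both_mem (.a i 4) (s := .s i 2) (s' := .sT i) (by simp)
  have d_a5 := hM.1.1.not_both_mem (.a i 5) (s := .s i 3) (s' := .sF i) (by simp)
  simp only [Tset, Fset, Finset.insert_subset_iff, Finset.singleton_subset_iff]
  grind
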